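/- Let V^A be a fixed vector with V·V = 1, and split Z^A = Z_∥^A + Z_⊥^A with Z_∥^A = (Z·V)V^A. Define the twisted-like operators 𝕃 = -ε_{ABC} V^C Z_⊥^A ∂_⊥^B and ℙ^A = Z_⊥^A - (N_⊥ + Δ(N_∥)) ∂_⊥^A, where N_⊥ = Z_⊥·∂_⊥, N_∥ = Z_∥·∂_∥, and Δ is an arbitrary polynomial function of N_∥. Then these operators satisfy the so(2,1) commutation relations [𝕃, ℙ^A] = ε^{ABC} V_C ℙ_B and [ℙ^A, ℙ^B] = ε^{ABC} V_C 𝕃. -/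

import Mathlib

noncomputable section

open MvPolynomial

-- Polynomials in the commuting variables `Z^0, Z^1, Z^2`.
abbrev P3 := MvPolynomial (Fin 3) ℝ

/-- The metric `η = diag(-1, 1, 1)` (equal to its own inverse). -/
def eta : Fin 3 → ℝ := ![-1, 1, 1]

/-- The Levi-Civita symbol `ε_{ABC}` with `ε_{012} = 1`. -/
def eps (A B C : Fin 3) : ℝ :=
  (((A : ℕ) : ℝ) - ((B : ℕ) : ℝ)) * (((B : ℕ) : ℝ) - ((C : ℕ) : ℝ)) *
    (((C : ℕ) : ℝ) - ((A : ℕ) : ℝ)) / 2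

/-- The partial derivative `∂/∂Z^A`. -/
def Dop (A : Fin 3) : P3 →ₗ[ℝ] P3 := (pderiv A).toLinearMap

/-- The polynomial `Z·V = η_{AB} Z^A V^B`. -/
def ZdotV (V : Fin 3 → ℝ) : P3 := ∑ A : Fin 3, C (eta A * V A) * X A

/-- The transverse variable `Z_⊥^A = Z^A - (Z·V) V^A`. -/
def Zperp (V : Fin 3 → ℝ) (A : Fin 3) : P3 := X A - C (V A) * ZdotV V

/-- The parallel variable `Z_∥^A = (Z·V) V^A`. -/
def Zpar (V : Fin 3 → ℝ) (A : Fin 3) : P3 := C (V A) * ZdotV V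

/-- The operator `V·∂ = V^A ∂/∂Z^A`. -/
def VdotD (V : Fin 3 → ℝ) : P3 →ₗ[ℝ] P3 := ∑ A : Fin 3, V A • Dop A

/-- The transverse derivative `∂_⊥^A = ∂/∂Z_A - V^A (V·∂)` (with `∂/∂Z_A = η^{AB} ∂_B`). -/
def Dperp (V : Fin 3 → ℝ) (A : Fin 3) : P3 →ₗ[ℝ] P3 := eta A • Dop A - V A • VdotD V

/-- The parallel derivative `∂_∥^A = V^A (V·∂)`. -/
def Dpar (V : Fin 3 → ℝ) (A : Fin 3) : P3 →ₗ[ℝ] P3 := V A • VdotD V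

/-- The transverse counting operator `N_⊥ = Z_⊥·∂_⊥ = η_{AB} Z_⊥^A ∂_⊥^B`. -/
def Nperp (V : Fin 3 → ℝ) : P3 →ₗ[ℝ] P3 :=
  ∑ A : Fin 3, eta A • (LinearMap.mulLeft ℝ (Zperp V A) ∘ₗ Dperp V A)

/-- The parallel counting operator `N_∥ = Z_∥·∂_∥`. -/
def Npar (V : Fin 3 → ℝ) : P3 →ₗ[ℝ] P3 :=
  ∑ A : Fin 3, eta A • (LinearMap.mulLeft ℝ (Zpar V A) ∘ₗ Dpar V A)

/-- The twisted-like Lorentz generator `𝕃 = -ε_{ABC} V^C Z_⊥^A ∂_⊥^B`. -/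
def Lgen (V : Fin 3 → ℝ) : P3 →ₗ[ℝ] P3 :=
  -∑ A : Fin 3, ∑ B : Fin 3, ∑ C : Fin 3,
    (eps A B C * V C) • (LinearMap.mulLeft ℝ (Zperp V A) ∘ₗ Dperp V B)

/-- The twisted-like transvection `ℙ^A = Z_⊥^A - (N_⊥ + Δ(N_∥)) ∂_⊥^A`, where `Δ` is an
arbitrary polynomial evaluated at the operator `N_∥`. -/
def Pgen (V : Fin 3 → ℝ) (Δ : Polynomial ℝ) (A : Fin 3) : P3 →ₗ[ℝ] P3 :=
  LinearMap.mulLeft ℝ (Zperp V A) -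
    ((Nperp V + Polynomial.aeval (Npar V : Module.End ℝ P3) Δ) ∘ₗ Dperp V A)

section Abstract

variable {R : Type*} [Ring R] [Algebra ℝ R]

def absN (z d : Fin 3 → R) : R := ∑ A : Fin 3, eta A • (z A * d A)

def absL (V : Fin 3 → ℝ) (z d : Fin 3 → R) : R :=
  -∑ A : Fin 3, ∑ B : Fin 3, ∑ C : Fin 3, (eps A B C * V C) • (z A * d B)

def hh (V : Fin 3 → ℝ) (A B : Fin 3) : ℝ := (if A = B then eta A else 0) - V A * V B

theorem hh_symm (V : Fin 3 → ℝ) (A B : Fin 3) : hh V A B = hh V B A := by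
  unfold hh
  by_cases h : A = B
  · subst h; rfl
  · rw [if_neg h, if_neg (Ne.symm h)]; ring

theorem abs_zd_z (V : Fin 3 → ℝ) (z d : Fin 3 → R) (hzz : ∀ A B, z A * z B = z B * z A)
    (hdz : ∀ A B, d A * z B = z B * d A + hh V A B • (1 : R)) (M N A : Fin 3) :
    (z M * d N) * z A = z A * (z M * d N) + hh V N A • z M := by
  rw [mul_assoc, hdz, mul_add, ← mul_assoc, hzz M A, mul_assoc]
  simp

theorem abs_zd_d (V : Fin 3 → ℝ) (z d : Fin 3 → R) (hdd : ∀ A B, d A * d B = d B * d A)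
    (hdz : ∀ A B, d A * z B = z B * d A + hh V A B • (1 : R)) (M N A : Fin 3) :
    (z M * d N) * d A = d A * (z M * d N) - hh V A M • d N := by
  rw [← mul_assoc (d A), hdz, add_mul, mul_assoc, mul_assoc, hdd N A]
  simp

theorem abs_N_z (V : Fin 3 → ℝ) (z d : Fin 3 → R) (hzz : ∀ A B, z A * z B = z B * z A)
    (hdz : ∀ A B, d A * z B = z B * d A + hh V A B • (1 : R))
    (tz : ∑ A : Fin 3, (eta A * V A) • z A = 0) (A : Fin 3) :
    absN z d * z A = z A * absN z d + z A := by
  simp only [Fin.sum_univ_three] at tz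
  simp only [absN, Fin.sum_univ_three, add_mul, mul_add, smul_mul_assoc, mul_smul_comm,
    abs_zd_z V z d hzz hdz]
  fin_cases A <;> simp [hh, eta] at tz ⊢
  · linear_combination (norm := module) (-V 0) • tz
  · linear_combination (norm := module) (-V 1) • tz
  · linear_combination (norm := module) (-V 2) • tz

theorem abs_N_d (V : Fin 3 → ℝ) (z d : Fin 3 → R) (hdd : ∀ A B, d A * d B = d B * d A)
    (hdz : ∀ A B, d A * z B = z B * d A + hh V A B • (1 : R))
    (td : ∑ A : Fin 3, (eta A * V A) • d A = 0) (A : Fin 3) :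
    absN z d * d A = d A * absN z d - d A := by
  simp only [Fin.sum_univ_three] at td
  simp only [absN, Fin.sum_univ_three, add_mul, mul_add, smul_mul_assoc, mul_smul_comm,
    abs_zd_d V z d hdd hdz]
  fin_cases A <;> simp [hh, eta] at td ⊢
  · linear_combination (norm := module) (V 0) • td
  · linear_combination (norm := module) (V 1) • td
  · linear_combination (norm := module) (V 2) • td

theorem abs_L_z (V : Fin 3 → ℝ) (z d : Fin 3 → R) (hzz : ∀ A B, z A * z B = z B * z A)
    (hdz : ∀ A B, d A * z B = z B * d A + hh V A B • (1 : R)) (A : Fin 3) :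
    absL V z d * z A = z A * absL V z d +
      eta A • ∑ B : Fin 3, ∑ C : Fin 3, (eps A B C * V C) • z B := by
  simp only [absL, Fin.sum_univ_three, add_mul, mul_add, smul_mul_assoc, mul_smul_comm,
    abs_zd_z V z d hzz hdz, neg_mul, mul_neg]
  fin_cases A <;> simp [hh, eta, eps] <;> module

theorem abs_L_d (V : Fin 3 → ℝ) (z d : Fin 3 → R) (hdd : ∀ A B, d A * d B = d B * d A)
    (hdz : ∀ A B, d A * z B = z B * d A + hh V A B • (1 : R)) (A : Fin 3) :
    absL V z d * d A = d A * absL V z d +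
      eta A • ∑ B : Fin 3, ∑ C : Fin 3, (eps A B C * V C) • d B := by
  simp only [absL, Fin.sum_univ_three, add_mul, mul_add, smul_mul_assoc, mul_smul_comm,
    abs_zd_d V z d hdd hdz, neg_mul, mul_neg]
  fin_cases A <;> simp [hh, eta, eps] <;> module

theorem abs_comm_L (V : Fin 3 → ℝ) (z d : Fin 3 → R) (T : R)
    (h : ∀ A B, Commute T (z A * d B)) : Commute T (absL V z d) := by
  unfold absL
  refine Commute.neg_right ?_
  refine Commute.sum_right _ _ _ fun A _ => Commute.sum_right _ _ _ fun B _ =>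
    Commute.sum_right _ _ _ fun C _ => ?_
  exact (h A B).smul_right _

theorem abs_rot (V : Fin 3 → ℝ) (hV : ∑ A : Fin 3, eta A * V A * V A = 1) (z d : Fin 3 → R)
    (tz : ∑ A : Fin 3, (eta A * V A) • z A = 0)
    (td : ∑ A : Fin 3, (eta A * V A) • d A = 0) (A B : Fin 3) :
    z A * d B - z B * d A =
      (eta A * eta B) • ∑ C : Fin 3, (eps A B C * V C) • absL V z d := by
  have h1 : ∀ N, ∑ A : Fin 3, (eta A * V A) • (z A * d N) = 0 := by
    intro N
    have := congrArg (· * d N) tz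
    simpa [Finset.sum_mul] using this
  have h2 : ∀ N, ∑ A : Fin 3, (eta A * V A) • (z N * d A) = 0 := by
    intro N
    have := congrArg (z N * ·) td
    simpa [Finset.mul_sum] using this
  have h10 := h1 0
  have h11 := h1 1
  have h12 := h1 2
  have h20 := h2 0
  have h21 := h2 1
  have h22 := h2 2
  clear h1 h2 tz td
  simp only [absL]
  generalize hw : (fun M N => z M * d N) = w
  have hw' : ∀ M N, z M * d N = w M N := fun M N => by rw [← hw]
  simp only [hw'] at *
  clear hw hw'
  simp only [Fin.sum_univ_three] at *
  simp [eta] at hV h10 h11 h12 h20 h21 h22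
  fin_cases A <;> fin_cases B <;> simp [eta, eps]
  · linear_combination (norm := module) (-1 : ℝ) • (V 0 • h21 - V 0 • h11 + V 1 • h10 - V 1 • h20 + hV • (w 0 1 - w 1 0))
  · linear_combination (norm := module) (-1 : ℝ) • (V 2 • h10 - V 2 • h20 - V 0 • h12 + V 0 • h22 + hV • (w 0 2 - w 2 0))
  · linear_combination (norm := module) V 0 • h21 - V 0 • h11 + V 1 • h10 - V 1 • h20 + hV • (w 0 1 - w 1 0)
  · linear_combination (norm := module) (-1 : ℝ) • (V 2 • h11 - V 2 • h21 + V 1 • h22 - V 1 • h12 + hV • (w 1 2 - w 2 1))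
  · linear_combination (norm := module) V 2 • h10 - V 2 • h20 - V 0 • h12 + V 0 • h22 + hV • (w 0 2 - w 2 0)
  · linear_combination (norm := module) V 2 • h11 - V 2 • h21 + V 1 • h22 - V 1 • h12 + hV • (w 1 2 - w 2 1)

theorem abs_main (V : Fin 3 → ℝ) (hV : ∑ A : Fin 3, eta A * V A * V A = 1) (z d : Fin 3 → R)
    (hzz : ∀ A B, z A * z B = z B * z A) (hdd : ∀ A B, d A * d B = d B * d A)
    (hdz : ∀ A B, d A * z B = z B * d A + hh V A B • (1 : R))
    (tz : ∑ A : Fin 3, (eta A * V A) • z A = 0)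
    (td : ∑ A : Fin 3, (eta A * V A) • d A = 0)
    (T : R) (hTz : ∀ A, Commute T (z A)) (hTd : ∀ A, Commute T (d A))
    (p : Fin 3 → R) (hp : ∀ A, p A = z A - (absN z d + T) * d A) :
    (∀ A, absL V z d * p A - p A * absL V z d =
        eta A • ∑ B : Fin 3, ∑ C : Fin 3, (eps A B C * V C) • p B) ∧
    (∀ A B : Fin 3, p A * p B - p B * p A =
        (eta A * eta B) • ∑ C : Fin 3, (eps A B C * V C) • absL V z d) := by
  have hMz : ∀ A, (absN z d + T) * z A = z A * (absN z d + T) + z A := by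
    intro A
    rw [add_mul, mul_add, abs_N_z V z d hzz hdz tz, (hTz A).eq]; abel
  have hMd : ∀ A, (absN z d + T) * d A = d A * (absN z d + T) - d A := by
    intro A
    rw [add_mul, mul_add, abs_N_d V z d hdd hdz td, (hTd A).eq]; abel
  have hLz := abs_L_z V z d hzz hdz
  have hLd := abs_L_d V z d hdd hdz
  have hML : Commute (absN z d + T) (absL V z d) := by
    apply abs_comm_L
    intro A B
    change _ * _ = _ * _
    rw [← mul_assoc, hMz, add_mul, mul_assoc, hMd]
    noncomm_ring
  have hrot := abs_rot V hV z d tz td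
  generalize absN z d + T = M at *
  generalize absL V z d = L at *
  constructor
  · intro A
    have e : L * p A - p A * L = (L * z A - z A * L) - M * (L * d A - d A * L) := by
      have : L * M = M * L := hML.eq.symm
      rw [hp, mul_sub, ← mul_assoc, this]
      noncomm_ring
    rw [e, hLz, hLd]
    simp only [hp, add_sub_cancel_left, mul_smul_comm, Finset.mul_sum, smul_sub,
      Finset.sum_sub_distrib]
  · intro A B
    rw [← hrot, hp, hp]
    have e1 : z A * (M * d B) = M * z A * d B - z A * d B := by
      rw [hMz]; noncomm_ring
    have e2 : z B * (M * d A) = M * z B * d A - z B * d A := by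
      rw [hMz]; noncomm_ring
    have e3 : M * d A * z B = M * z B * d A + hh V A B • M := by
      rw [mul_assoc, hdz, mul_add, mul_assoc]; simp
    have e4 : M * d B * z A = M * z A * d B + hh V A B • M := by
      rw [mul_assoc, hdz, mul_add, mul_assoc, hh_symm]; simp
    have e5 : M * d A * (M * d B) = M * (M * (d A * d B)) + M * (d A * d B) := by
      have : d A * M = M * d A + d A := by rw [hMd]; abel
      calc _ = M * (d A * M) * d B := by noncomm_ring
        _ = _ := by rw [this]; noncomm_ring
    have e6 : M * d B * (M * d A) = M * (M * (d A * d B)) + M * (d A * d B) := by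
      have : d B * M = M * d B + d B := by rw [hMd]; abel
      calc _ = M * (d B * M) * d A := by noncomm_ring
        _ = M * (M * (d B * d A)) + M * (d B * d A) := by rw [this]; noncomm_ring
        _ = _ := by rw [hdd B A]
    simp only [sub_mul, mul_sub]
    rw [e1, e2, e3, e4, e5, e6, hzz A B]
    abel

end Abstract

theorem Dop_mul (A : Fin 3) (p q : P3) : Dop A (p * q) = p * Dop A q + q * Dop A p := by
  simp [Dop, Derivation.leibniz]

theorem Dop_comm (A B : Fin 3) (p : P3) : Dop A (Dop B p) = Dop B (Dop A p) := by
  have : ⁅(pderiv A : Derivation ℝ P3 P3), (pderiv B : Derivation ℝ P3 P3)⁆ = 0 := by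
    apply MvPolynomial.derivation_ext
    intro i
    rw [Derivation.commutator_apply]
    simp [pderiv_X, Pi.single_apply, apply_ite]
  have h := congrArg (fun D => D p) this
  simp only [Derivation.commutator_apply, Derivation.zero_apply] at h
  exact sub_eq_zero.mp h

theorem Dop_X (A B : Fin 3) : Dop A (X B : P3) = C (if A = B then 1 else 0) := by
  change pderiv A (X B : P3) = _
  rw [pderiv_X, Pi.single_apply]
  by_cases h : A = B
  · simp [h]
  · simp [h, Ne.symm h]

theorem Dop_CX (A B : Fin 3) (c : ℝ) : Dop A (C c * X B : P3) = C (if A = B then c else 0) := by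
  rw [← smul_eq_C_mul, map_smul, Dop_X, smul_eq_C_mul, ← C_mul]
  simp

theorem Dop_ZdotV (V : Fin 3 → ℝ) (A : Fin 3) : Dop A (ZdotV V) = C (eta A * V A) := by
  simp only [ZdotV, map_sum, Dop_CX]
  rw [← map_sum]
  simp

theorem Dop_Zperp (V : Fin 3 → ℝ) (A B : Fin 3) :
    Dop A (Zperp V B) = C ((if A = B then 1 else 0) - V B * (eta A * V A)) := by
  simp only [Zperp, map_sub, Dop_X, ← smul_eq_C_mul, map_smul, Dop_ZdotV]
  simp only [smul_eq_C_mul, ← C_mul, ← C_sub]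

theorem VdotD_mul (V : Fin 3 → ℝ) (p q : P3) :
    VdotD V (p * q) = p * VdotD V q + q * VdotD V p := by
  simp only [VdotD, LinearMap.sum_apply, LinearMap.smul_apply, Dop_mul, smul_add,
    Finset.sum_add_distrib, Finset.mul_sum, mul_smul_comm]

theorem Dperp_mul (V : Fin 3 → ℝ) (A : Fin 3) (p q : P3) :
    Dperp V A (p * q) = p * Dperp V A q + q * Dperp V A p := by
  simp only [Dperp, LinearMap.sub_apply, LinearMap.smul_apply, Dop_mul, VdotD_mul, smul_add,
    mul_sub, mul_smul_comm]
  abel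

theorem Dop_VdotD (V : Fin 3 → ℝ) (A : Fin 3) (p : P3) :
    Dop A (VdotD V p) = VdotD V (Dop A p) := by
  simp only [VdotD, LinearMap.sum_apply, LinearMap.smul_apply, map_sum, map_smul, Dop_comm A]

theorem Dperp_VdotD (V : Fin 3 → ℝ) (A : Fin 3) (p : P3) :
    Dperp V A (VdotD V p) = VdotD V (Dperp V A p) := by
  simp only [Dperp, LinearMap.sub_apply, LinearMap.smul_apply, map_sub, map_smul, Dop_VdotD]

theorem Dperp_Dop (V : Fin 3 → ℝ) (A B : Fin 3) (p : P3) :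
    Dperp V A (Dop B p) = Dop B (Dperp V A p) := by
  simp only [Dperp, LinearMap.sub_apply, LinearMap.smul_apply, map_sub, map_smul, Dop_VdotD,
    Dop_comm A]

theorem Dperp_comm (V : Fin 3 → ℝ) (A B : Fin 3) (p : P3) :
    Dperp V A (Dperp V B p) = Dperp V B (Dperp V A p) := by
  conv_lhs => rw [Dperp.eq_def V B]
  conv_rhs => rw [Dperp.eq_def V B]
  simp only [LinearMap.sub_apply, LinearMap.smul_apply, map_sub, map_smul, Dperp_VdotD, Dperp_Dop]

theorem VdotD_ZdotV (V : Fin 3 → ℝ) (hV : ∑ A : Fin 3, eta A * V A * V A = 1) :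
    VdotD V (ZdotV V) = 1 := by
  simp only [VdotD, LinearMap.sum_apply, LinearMap.smul_apply, Dop_ZdotV, smul_eq_C_mul,
    ← C_mul, ← map_sum]
  rw [← C_1, ← hV]
  congr 1
  exact Finset.sum_congr rfl fun A _ => by ring

theorem VdotD_Zperp (V : Fin 3 → ℝ) (hV : ∑ A : Fin 3, eta A * V A * V A = 1) (B : Fin 3) :
    VdotD V (Zperp V B) = 0 := by
  simp only [VdotD, LinearMap.sum_apply, LinearMap.smul_apply, Dop_Zperp, smul_eq_C_mul,
    ← C_mul, ← map_sum]
  rw [← C_0]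
  congr 1
  simp only [Fin.sum_univ_three] at *
  fin_cases B <;> simp
  · linear_combination (-V 0) * hV
  · linear_combination (-V 1) * hV
  · linear_combination (-V 2) * hV

theorem eta_sq (A : Fin 3) : eta A * eta A = 1 := by
  fin_cases A <;> simp [eta]

theorem Dperp_ZdotV (V : Fin 3 → ℝ) (hV : ∑ A : Fin 3, eta A * V A * V A = 1) (A : Fin 3) :
    Dperp V A (ZdotV V) = 0 := by
  simp only [Dperp, LinearMap.sub_apply, LinearMap.smul_apply, VdotD_ZdotV V hV, Dop_ZdotV,
    smul_eq_C_mul, ← C_mul, mul_one, ← C_sub]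
  rw [← mul_assoc, eta_sq]
  simp

theorem Dperp_Zperp (V : Fin 3 → ℝ) (hV : ∑ A : Fin 3, eta A * V A * V A = 1) (A B : Fin 3) :
    Dperp V A (Zperp V B) = C (hh V A B) := by
  simp only [Dperp, LinearMap.sub_apply, LinearMap.smul_apply, VdotD_Zperp V hV, Dop_Zperp,
    smul_eq_C_mul, ← C_mul, mul_zero, sub_zero]
  congr 1
  have := eta_sq A
  unfold hh
  split_ifs <;> linear_combination (-V A * V B) * this

theorem commute_aeval_of_commute {R : Type*} [Ring R] [Algebra ℝ R] (n x : R) (h : Commute n x)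
    (Δ : Polynomial ℝ) : Commute (Polynomial.aeval n Δ) x := by
  induction Δ using Polynomial.induction_on' with
  | add p q hp hq => rw [map_add]; exact hp.add_left hq
  | monomial k a =>
    rw [Polynomial.aeval_monomial]
    exact (Algebra.commute_algebraMap_left a x).mul_left (h.pow_left k)

theorem Npar_z (V : Fin 3 → ℝ) (hV : ∑ A : Fin 3, eta A * V A * V A = 1) (A : Fin 3) :
    Commute (Npar V : Module.End ℝ P3) (LinearMap.mulLeft ℝ (Zperp V A)) := by
  unfold Npar
  refine Commute.sum_left _ _ _ fun B _ => Commute.smul_left ?_ _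
  refine LinearMap.ext fun p => ?_
  simp [Dpar, VdotD_mul, VdotD_Zperp V hV]
  ring_nf

theorem Npar_d (V : Fin 3 → ℝ) (hV : ∑ A : Fin 3, eta A * V A * V A = 1) (A : Fin 3) :
    Commute (Npar V : Module.End ℝ P3) (Dperp V A) := by
  unfold Npar
  refine Commute.sum_left _ _ _ fun B _ => Commute.smul_left ?_ _
  refine LinearMap.ext fun p => ?_
  simp [Dpar, Zpar, Dperp_mul, Dperp_ZdotV V hV, Dperp_VdotD, ← smul_eq_C_mul]

/-- The twisted-like operators `𝕃` and `ℙ^A` satisfy the `so(2,1)` commutation relations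
`[𝕃, ℙ^A] = ε^{ABC} V_C ℙ_B` and `[ℙ^A, ℙ^B] = ε^{ABC} V_C 𝕃` (written here with all
indices lowered by the diagonal metric `η`). -/
theorem twisted_like_so21 (V : Fin 3 → ℝ) (hV : ∑ A : Fin 3, eta A * V A * V A = 1)
    (Δ : Polynomial ℝ) :
    (∀ A : Fin 3,
      Lgen V ∘ₗ Pgen V Δ A - Pgen V Δ A ∘ₗ Lgen V =
        eta A • ∑ B : Fin 3, ∑ C : Fin 3, (eps A B C * V C) • Pgen V Δ B) ∧
    (∀ A B : Fin 3,
      Pgen V Δ A ∘ₗ Pgen V Δ B - Pgen V Δ B ∘ₗ Pgen V Δ A =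
        (eta A * eta B) • ∑ C : Fin 3, (eps A B C * V C) • Lgen V) := by
  have tz : ∑ A : Fin 3, (eta A * V A) •
      (LinearMap.mulLeft ℝ (Zperp V A) : Module.End ℝ P3) = 0 := by
    have h0 : ∑ A : Fin 3, (eta A * V A) • Zperp V A = 0 := by
      have e : ∀ A, (eta A * V A) • Zperp V A =
          C (eta A * V A) * X A - C (eta A * V A * V A) * ZdotV V := by
        intro A
        rw [Zperp, smul_eq_C_mul, mul_sub, ← mul_assoc, ← C_mul]
      simp only [e, Finset.sum_sub_distrib, ← Finset.sum_mul, ← map_sum, hV]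
      simp [ZdotV]
    refine LinearMap.ext fun p => ?_
    have := congrArg (· * p) h0
    simpa [Finset.sum_mul] using this
  have td : ∑ A : Fin 3, (eta A * V A) • (Dperp V A : Module.End ℝ P3) = 0 := by
    have e : ∀ A, (eta A * V A) • (Dperp V A : Module.End ℝ P3) =
        V A • Dop A - (eta A * V A * V A) • VdotD V := by
      intro A
      rw [Dperp, smul_sub, smul_smul, smul_smul]
      congr 2
      linear_combination V A * eta_sq A
    simp only [e, Finset.sum_sub_distrib, ← Finset.sum_smul, hV]
    simp [VdotD]
  have key := abs_main (R := Module.End ℝ P3) V hV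
    (fun A => LinearMap.mulLeft ℝ (Zperp V A)) (fun A => Dperp V A)
    (fun A B => LinearMap.ext fun p => by simp; ring)
    (fun A B => LinearMap.ext fun p => by simp [Dperp_comm V A B])
    (fun A B => LinearMap.ext fun p => by
      simp [Dperp_mul, Dperp_Zperp V hV, smul_eq_C_mul]; ring)
    tz td (Polynomial.aeval (Npar V : Module.End ℝ P3) Δ)
    (fun A => commute_aeval_of_commute _ _ (Npar_z V hV A) Δ)
    (fun A => commute_aeval_of_commute _ _ (Npar_d V hV A) Δ)
    (Pgen V Δ) (fun A => rfl)
  exact key
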